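/- Let I ⊆ ℝ be an open interval. Let u : I×ℝ → ℂ have continuous partial derivatives up to order one in t and order three in x (with the mixed derivative ∂_t∂_x u continuous), and let n, v : I×ℝ → ℝ be continuously differentiable. Assume that on I×ℝ the Zakharov system (ZL) holds pointwise: ∂_t u = i·∂_x² u − i·n·u, ∂_t n = −∂_x v, ∂_t v = −∂_x n − ∂_x(|u|²). Assume that for every compact J ⊆ I there exist C > 0 and δ > 0 such that |u| + |∂_x u| + |∂_x² u| + |∂_x³ u| + |n| + |v| + |∂_x n| + |∂_x v| ≤ C·e^{−δ|x|} on J×ℝ. Let χ : I×ℝ → ℝ be twice continuously differentiable with χ, ∂_t χ, ∂_x χ and ∂_x² χ bounded on J×ℝ for every compact J ⊆ I. Then the function t ↦ Im ∫_ℝ ∂_x u(t,x)·conj(u(t,x))·χ(t,x) dx + ∫_ℝ n(t,x)·v(t,x)·χ(t,x) dx is differentiable on I, with derivative equal to 2∫_ℝ |∂_x u|²·∂_x χ dx + Re ∫_ℝ conj(u)·∂_x u·∂_x² χ dx + ∫_ℝ ( n·|u|² + (v² + n²)/2 )·∂_x χ dx + ∫_ℝ ( Im(conj(u)·∂_x u)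 + n·v )·∂_t χ dx. -/

import Mathlib

open MeasureTheory

theorem zl_integrable_exp {δ : ℝ} (hδ : 0 < δ) :
    Integrable (fun x : ℝ => Real.exp (-δ * |x|)) := by
  have h1 : IntegrableOn (fun x : ℝ => Real.exp (-δ * |x|)) (Set.Ioi 0) := by
    refine (integrableOn_exp_mul_Ioi (a := -δ) (by linarith) 0).congr_fun ?_ measurableSet_Ioi
    intro x hx
    simp only [abs_of_pos (Set.mem_Ioi.1 hx)]
  have h2 : IntegrableOn (fun x : ℝ => Real.exp (-δ * |x|)) (Set.Iic 0) := by
    refine (integrableOn_exp_mul_Iic (a := δ) hδ 0).congr_fun ?_ measurableSet_Iic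
    intro x hx
    simp only [abs_of_nonpos (Set.mem_Iic.1 hx)]
    ring_nf
  have := h2.union h1
  rwa [Set.Iic_union_Ioi, integrableOn_univ] at this

/-- continuous in `x`, and `O(exp (-δ |x|))` uniformly for `s ∈ J`. -/
def ZLDec (J : Set ℝ) (δ : ℝ) (f : ℝ → ℝ → ℝ) : Prop :=
  (∀ s ∈ J, Continuous (f s)) ∧
    ∃ K : ℝ, 0 ≤ K ∧ ∀ s ∈ J, ∀ x : ℝ, |f s x| ≤ K * Real.exp (-δ * |x|)

namespace ZLDec

variable {J : Set ℝ} {δ : ℝ} {f g : ℝ → ℝ → ℝ}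

theorem add (hf : ZLDec J δ f) (hg : ZLDec J δ g) : ZLDec J δ (fun s x => f s x + g s x) := by
  obtain ⟨cf, K, hK, hf⟩ := hf
  obtain ⟨cg, L, hL, hg⟩ := hg
  refine ⟨fun s hs => (cf s hs).add (cg s hs), K + L, by positivity, fun s hs x => ?_⟩
  have := abs_add_le (f s x) (g s x)
  linarith [hf s hs x, hg s hs x]

theorem neg (hf : ZLDec J δ f) : ZLDec J δ (fun s x => - f s x) := by
  obtain ⟨cf, K, hK, hf⟩ := hf
  exact ⟨fun s hs => (cf s hs).neg, K, hK, fun s hs x => by rw [abs_neg]; exact hf s hs x⟩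

theorem sub (hf : ZLDec J δ f) (hg : ZLDec J δ g) : ZLDec J δ (fun s x => f s x - g s x) := by
  simpa only [sub_eq_add_neg] using hf.add hg.neg

theorem mul0 (hf : ZLDec J δ f) (hg : ZLDec J 0 g) : ZLDec J δ (fun s x => f s x * g s x) := by
  obtain ⟨cf, K, hK, hf⟩ := hf
  obtain ⟨cg, L, hL, hg⟩ := hg
  refine ⟨fun s hs => (cf s hs).mul (cg s hs), K * L, by positivity, fun s hs x => ?_⟩
  have h2 := hg s hs x
  rw [neg_zero, zero_mul, Real.exp_zero, mul_one] at h2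
  rw [abs_mul]
  calc |f s x| * |g s x| ≤ (K * Real.exp (-δ * |x|)) * L := by
        gcongr
        exact hf s hs x
    _ = _ := by ring

theorem bdd (hδ : 0 < δ) (hf : ZLDec J δ f) : ZLDec J 0 f := by
  obtain ⟨cf, K, hK, hf⟩ := hf
  refine ⟨cf, K, hK, fun s hs x => (hf s hs x).trans ?_⟩
  gcongr

theorem mul (hδ : 0 < δ) (hf : ZLDec J δ f) (hg : ZLDec J δ g) :
    ZLDec J δ (fun s x => f s x * g s x) := hf.mul0 (hg.bdd hδ)

theorem const_mul (a : ℝ) (hf : ZLDec J δ f) : ZLDec J δ (fun s x => a * f s x) := by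
  obtain ⟨cf, K, hK, hf⟩ := hf
  refine ⟨fun s hs => continuous_const.mul (cf s hs), |a| * K, by positivity, fun s hs x => ?_⟩
  rw [abs_mul, mul_assoc]
  gcongr
  exact hf s hs x

theorem integrable (hδ : 0 < δ) (hf : ZLDec J δ f) {s : ℝ} (hs : s ∈ J) :
    Integrable (f s) := by
  obtain ⟨cf, K, hK, hf⟩ := hf
  refine ((zl_integrable_exp hδ).const_mul K).mono' (cf s hs).aestronglyMeasurable ?_
  exact Filter.Eventually.of_forall fun x => hf s hs x

end ZLDec

theorem zl_core (t δ : ℝ) (J : Set ℝ) (hJ : J ∈ nhds t) (hδ : 0 < δ)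
    (p0 p1 p2 p3 q0 q1 q2 q3 n v nx vx c ct cx cxx : ℝ → ℝ → ℝ)
    (dp0 : ZLDec J δ p0) (dp1 : ZLDec J δ p1) (dp2 : ZLDec J δ p2) (dp3 : ZLDec J δ p3)
    (dq0 : ZLDec J δ q0) (dq1 : ZLDec J δ q1) (dq2 : ZLDec J δ q2) (dq3 : ZLDec J δ q3)
    (dn : ZLDec J δ n) (dv : ZLDec J δ v) (dnx : ZLDec J δ nx) (dvx : ZLDec J δ vx)
    (dc : ZLDec J 0 c) (dct : ZLDec J 0 ct) (dcx : ZLDec J 0 cx) (dcxx : ZLDec J 0 cxx)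
    (xp0 : ∀ x, HasDerivAt (p0 t) (p1 t x) x) (xp1 : ∀ x, HasDerivAt (p1 t) (p2 t x) x)
    (xp2 : ∀ x, HasDerivAt (p2 t) (p3 t x) x)
    (xq0 : ∀ x, HasDerivAt (q0 t) (q1 t x) x) (xq1 : ∀ x, HasDerivAt (q1 t) (q2 t x) x)
    (xq2 : ∀ x, HasDerivAt (q2 t) (q3 t x) x)
    (xn : ∀ x, HasDerivAt (n t) (nx t x) x) (xv : ∀ x, HasDerivAt (v t) (vx t x) x)
    (xc : ∀ x, HasDerivAt (c t) (cx t x) x) (xcx : ∀ x, HasDerivAt (cx t) (cxx t x) x)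
    (tp0 : ∀ s ∈ J, ∀ x, HasDerivAt (fun r => p0 r x) (-q2 s x + n s x * q0 s x) s)
    (tq0 : ∀ s ∈ J, ∀ x, HasDerivAt (fun r => q0 r x) (p2 s x - n s x * p0 s x) s)
    (tp1 : ∀ s ∈ J, ∀ x, HasDerivAt (fun r => p1 r x)
      (-q3 s x + (nx s x * q0 s x + n s x * q1 s x)) s)
    (tq1 : ∀ s ∈ J, ∀ x, HasDerivAt (fun r => q1 r x)
      (p3 s x - (nx s x * p0 s x + n s x * p1 s x)) s)
    (tn : ∀ s ∈ J, ∀ x, HasDerivAt (fun r => n r x) (-vx s x) s)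
    (tv : ∀ s ∈ J, ∀ x, HasDerivAt (fun r => v r x)
      (-nx s x - 2 * (p0 s x * p1 s x + q0 s x * q1 s x)) s)
    (tc : ∀ s ∈ J, ∀ x, HasDerivAt (fun r => c r x) (ct s x) s) :
    HasDerivAt (fun s => (∫ x, (q1 s x * p0 s x - p1 s x * q0 s x) * c s x)
        + ∫ x, n s x * v s x * c s x)
      (2 * (∫ x, (p1 t x * p1 t x + q1 t x * q1 t x) * cx t x)
        + (∫ x, (p0 t x * p1 t x + q0 t x * q1 t x) * cxx t x)
        + (∫ x, (n t x * (p0 t x * p0 t x + q0 t x * q0 t x)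
            + (1 / 2) * (v t x * v t x + n t x * n t x)) * cx t x)
        + ∫ x, (q1 t x * p0 t x - p1 t x * q0 t x + n t x * v t x) * ct t x) t := by
  have htJ : t ∈ J := mem_of_mem_nhds hJ
  -- pieces
  have dQ : ZLDec J δ (fun s x => q1 s x * p0 s x - p1 s x * q0 s x) :=
    (dq1.mul hδ dp0).sub (dp1.mul hδ dq0)
  have dnv : ZLDec J δ (fun s x => n s x * v s x) := dn.mul hδ dv
  have dR : ZLDec J δ (fun s x => p0 s x * p1 s x + q0 s x * q1 s x) :=
    (dp0.mul hδ dp1).add (dq0.mul hδ dq1)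
  have dA : ZLDec J δ (fun s x => p1 s x * p1 s x + q1 s x * q1 s x) :=
    (dp1.mul hδ dp1).add (dq1.mul hδ dq1)
  have dU : ZLDec J δ (fun s x => p0 s x * p0 s x + q0 s x * q0 s x) :=
    (dp0.mul hδ dp0).add (dq0.mul hδ dq0)
  have dN : ZLDec J δ (fun s x => n s x * (p0 s x * p0 s x + q0 s x * q0 s x)
      + (1 / 2) * (v s x * v s x + n s x * n s x)) :=
    (dn.mul hδ dU).add (((dv.mul hδ dv).add (dn.mul hδ dn)).const_mul _)
  have dP : ZLDec J δ (fun s x => p2 s x * p0 s x + q2 s x * q0 s x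
      - (p1 s x * p1 s x + q1 s x * q1 s x)
      - (n s x * (p0 s x * p0 s x + q0 s x * q0 s x)
      + (1 / 2) * (v s x * v s x + n s x * n s x))) :=
    (((dp2.mul hδ dp0).add (dq2.mul hδ dq0)).sub dA).sub dN
  have dPx : ZLDec J δ (fun s x => p3 s x * p0 s x + q3 s x * q0 s x
      - (p2 s x * p1 s x + q2 s x * q1 s x)
      - (nx s x * (p0 s x * p0 s x + q0 s x * q0 s x)
        + n s x * (2 * (p0 s x * p1 s x + q0 s x * q1 s x)))
      - (v s x * vx s x + n s x * nx s x)) :=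
    ((((dp3.mul hδ dp0).add (dq3.mul hδ dq0)).sub ((dp2.mul hδ dp1).add (dq2.mul hδ dq1))).sub
      ((dnx.mul hδ dU).add (dn.mul hδ (dR.const_mul 2)))).sub
        ((dv.mul hδ dvx).add (dn.mul hδ dnx))
  have dF : ZLDec J δ (fun s x => (q1 s x * p0 s x - p1 s x * q0 s x) * c s x
      + n s x * v s x * c s x) := (dQ.mul0 dc).add (dnv.mul0 dc)
  have dQt : ZLDec J δ (fun s x => (q1 s x * p0 s x - p1 s x * q0 s x + n s x * v s x)
      * ct s x) := (dQ.add dnv).mul0 dct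
  have dFt := (dPx.mul0 dc).add dQt
  have dH := (dP.mul0 dc).sub (dR.mul0 dcx)
  have dG1 := dA.mul0 dcx
  have dG2 := dR.mul0 dcxx
  have dG3 := dN.mul0 dcx
  have dG := (((dG1.const_mul 2).add dG2).add dG3).add dQt
  have dHx := dFt.sub dG
  -- differentiate under the integral
  obtain ⟨_, K, hK, hbound⟩ := id dFt
  have key := (hasDerivAt_integral_of_dominated_loc_of_deriv_le hJ
    (Filter.eventually_of_mem hJ fun s hs => (dF.1 s hs).aestronglyMeasurable)
    (dF.integrable hδ htJ) (dFt.1 t htJ).aestronglyMeasurable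
    (Filter.Eventually.of_forall fun x s hs => hbound s hs x)
    ((zl_integrable_exp hδ).const_mul K)
    (Filter.Eventually.of_forall fun x s hs => by
      have h := ((((tq1 s hs x).mul (tp0 s hs x)).sub ((tp1 s hs x).mul (tq0 s hs x))).mul
        (tc s hs x)).add (((tn s hs x).mul (tv s hs x)).mul (tc s hs x))
      refine h.congr_deriv ?_
      simp only [Pi.mul_apply, Pi.sub_apply]
      ring)).2
  have hz := integral_eq_zero_of_hasDerivAt_of_integrable
    (fun x => by
      have h := ((((((xp2 x).mul (xp0 x)).add ((xq2 x).mul (xq0 x))).sub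
        (((xp1 x).mul (xp1 x)).add ((xq1 x).mul (xq1 x)))).sub
        (((xn x).mul (((xp0 x).mul (xp0 x)).add ((xq0 x).mul (xq0 x)))).add
          ((((xv x).mul (xv x)).add ((xn x).mul (xn x))).const_mul (1/2)))).mul (xc x)).sub
          ((((xp0 x).mul (xp1 x)).add ((xq0 x).mul (xq1 x))).mul (xcx x))
      refine h.congr_deriv ?_
      simp only [Pi.mul_apply, Pi.sub_apply, Pi.add_apply]
      ring) (dHx.integrable hδ htJ) (dH.integrable hδ htJ)
  rw [integral_sub (dFt.integrable hδ htJ) (dG.integrable hδ htJ), sub_eq_zero] at hz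
  rw [hz, integral_add ((((dG1.const_mul 2).add dG2).add dG3).integrable hδ htJ)
      (dQt.integrable hδ htJ),
    integral_add (((dG1.const_mul 2).add dG2).integrable hδ htJ) (dG3.integrable hδ htJ),
    integral_add ((dG1.const_mul 2).integrable hδ htJ) (dG2.integrable hδ htJ),
    integral_const_mul] at key
  refine key.congr_of_eventuallyEq (Filter.eventually_of_mem hJ fun s hs => ?_)
  exact (integral_add ((dQ.mul0 dc).integrable hδ hs) ((dnv.mul0 dc).integrable hδ hs)).symm

theorem zl_mixed (a b : ℝ) (u : ℝ → ℝ → ℂ) (ut ux utx : ℝ → ℝ → ℂ)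
    (hut : ∀ t ∈ Set.Ioo a b, ∀ x, HasDerivAt (fun s => u s x) (ut t x) t)
    (hux : ∀ t ∈ Set.Ioo a b, ∀ x, HasDerivAt (fun y => u t y) (ux t x) x)
    (hutx : ∀ t ∈ Set.Ioo a b, ∀ x, HasDerivAt (fun s => ux s x) (utx t x) t)
    (cux : ContinuousOn (fun p : ℝ × ℝ => ux p.1 p.2) (Set.Ioo a b ×ˢ Set.univ))
    (cutx : ContinuousOn (fun p : ℝ × ℝ => utx p.1 p.2) (Set.Ioo a b ×ˢ Set.univ))
    {t : ℝ} (ht : t ∈ Set.Ioo a b) (x : ℝ) : HasDerivAt (fun y => ut t y) (utx t x) x := by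
  have slice : ∀ {f : ℝ → ℝ → ℂ},
      ContinuousOn (fun p : ℝ × ℝ => f p.1 p.2) (Set.Ioo a b ×ˢ Set.univ) →
      ∀ s ∈ Set.Ioo a b, Continuous (f s) := by
    intro f hf s hs
    have := hf.comp (f := fun x : ℝ => (s, x)) (s := Set.univ) (by fun_prop)
      (fun y _ => ⟨hs, Set.mem_univ _⟩)
    exact continuousOn_univ.1 this
  obtain ⟨ε, hε, hball⟩ := Metric.nhds_basis_closedBall.mem_iff.1 (isOpen_Ioo.mem_nhds ht)
  have hmem : Metric.closedBall t ε ∈ nhds t := Metric.closedBall_mem_nhds t hε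
  have key : ∀ y, ut t y = ut t x + ∫ z in x..y, utx t z := by
    intro y
    have hc : IsCompact (Metric.closedBall t ε ×ˢ Set.uIcc x y) :=
      (isCompact_closedBall t ε).prod isCompact_uIcc
    obtain ⟨M, hM⟩ := hc.exists_bound_of_continuousOn
      (cutx.mono (Set.prod_mono hball (Set.subset_univ _)))
    have h1 := (intervalIntegral.hasDerivAt_integral_of_dominated_loc_of_deriv_le
      (μ := volume) (a := x) (b := y) (F := ux) (F' := utx) (bound := fun _ => M) hmem
      (Filter.eventually_of_mem hmem fun s hs =>
        (slice cux s (hball hs)).aestronglyMeasurable)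
      ((slice cux t ht).intervalIntegrable _ _)
      (slice cutx t ht).aestronglyMeasurable
      (Filter.Eventually.of_forall fun z hz s hs =>
        hM (s, z) ⟨hs, Set.uIoc_subset_uIcc hz⟩)
      intervalIntegrable_const
      (Filter.Eventually.of_forall fun z _ s hs => hutx s (hball hs) z)).2
    have h2 : HasDerivAt (fun s => ∫ z in x..y, ux s z) (ut t y - ut t x) t := by
      refine ((hut t ht y).sub (hut t ht x)).congr_of_eventuallyEq
        (Filter.eventually_of_mem hmem fun s hs => ?_)
      exact intervalIntegral.integral_eq_sub_of_hasDerivAt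
        (fun z _ => hux s (hball hs) z) ((slice cux s (hball hs)).intervalIntegrable _ _)
    rw [h1.unique h2]
    ring
  have h3 := ((slice cutx t ht).integral_hasStrictDerivAt x x).hasDerivAt.const_add (ut t x)
  exact h3.congr_of_eventuallyEq (Filter.Eventually.of_forall key)

theorem zl_re {f : ℝ → ℂ} {f' : ℂ} {x : ℝ} (h : HasDerivAt f f' x) :
    HasDerivAt (fun y => (f y).re) f'.re x :=
  Complex.reCLM.hasFDerivAt.comp_hasDerivAt x h

theorem zl_im {f : ℝ → ℂ} {f' : ℂ} {x : ℝ} (h : HasDerivAt f f' x) :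
    HasDerivAt (fun y => (f y).im) f'.im x :=
  Complex.imCLM.hasFDerivAt.comp_hasDerivAt x h

theorem zl_slice {E : Type*} [TopologicalSpace E] {a b : ℝ} {f : ℝ → ℝ → E}
    (hf : ContinuousOn (fun p : ℝ × ℝ => f p.1 p.2) (Set.Ioo a b ×ˢ Set.univ))
    {s : ℝ} (hs : s ∈ Set.Ioo a b) : Continuous (f s) := by
  have := hf.comp (f := fun x : ℝ => (s, x)) (s := Set.univ) (by fun_prop)
    (fun y _ => ⟨hs, Set.mem_univ _⟩)
  exact continuousOn_univ.1 this

/-- Differentiation of the localized momentum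
`t ↦ Im ∫ ∂_x u · conj u · χ + ∫ n·v·χ` along a solution of the one-dimensional Zakharov
system on an open interval `I = (a,b)`, with exponential decay in `x` and a bounded `C²`
weight `χ`. -/
theorem hasDerivAt_localized_momentum (a b : ℝ) (u : ℝ → ℝ → ℂ) (n v : ℝ → ℝ → ℝ)
    (χ : ℝ → ℝ → ℝ)
    -- `u` has partial derivatives of order one in `t` and order three in `x` on `I × ℝ`
    (hu_t : ∀ t ∈ Set.Ioo a b, ∀ x : ℝ, DifferentiableAt ℝ (fun s => u s x) t)
    (hu_x : ∀ t ∈ Set.Ioo a b, ∀ x : ℝ, DifferentiableAt ℝ (fun y => u t y) x)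
    (hu_xx : ∀ t ∈ Set.Ioo a b, ∀ x : ℝ,
      DifferentiableAt ℝ (deriv (fun y => u t y)) x)
    (hu_xxx : ∀ t ∈ Set.Ioo a b, ∀ x : ℝ,
      DifferentiableAt ℝ (deriv (deriv (fun y => u t y))) x)
    -- the mixed derivative `∂_t ∂_x u` exists
    (hu_tx : ∀ t ∈ Set.Ioo a b, ∀ x : ℝ,
      DifferentiableAt ℝ (fun s => deriv (fun y => u s y) x) t)
    -- these partial derivatives (and `u` itself) are continuous on `I × ℝ`
    (hcont_u : ContinuousOn (fun p : ℝ × ℝ => u p.1 p.2) (Set.Ioo a b ×ˢ Set.univ))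
    (hcont_ut : ContinuousOn (fun p : ℝ × ℝ => deriv (fun s => u s p.2) p.1)
      (Set.Ioo a b ×ˢ Set.univ))
    (hcont_ux : ContinuousOn (fun p : ℝ × ℝ => deriv (fun y => u p.1 y) p.2)
      (Set.Ioo a b ×ˢ Set.univ))
    (hcont_uxx : ContinuousOn (fun p : ℝ × ℝ => deriv (deriv (fun y => u p.1 y)) p.2)
      (Set.Ioo a b ×ˢ Set.univ))
    (hcont_uxxx : ContinuousOn
      (fun p : ℝ × ℝ => deriv (deriv (deriv (fun y => u p.1 y))) p.2)
      (Set.Ioo a b ×ˢ Set.univ))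
    (hcont_utx : ContinuousOn
      (fun p : ℝ × ℝ => deriv (fun s => deriv (fun y => u s y) p.2) p.1)
      (Set.Ioo a b ×ˢ Set.univ))
    -- `n` and `v` are continuously differentiable on `I × ℝ`
    (hn_t : ∀ t ∈ Set.Ioo a b, ∀ x : ℝ, DifferentiableAt ℝ (fun s => n s x) t)
    (hn_x : ∀ t ∈ Set.Ioo a b, ∀ x : ℝ, DifferentiableAt ℝ (fun y => n t y) x)
    (hv_t : ∀ t ∈ Set.Ioo a b, ∀ x : ℝ, DifferentiableAt ℝ (fun s => v s x) t)
    (hv_x : ∀ t ∈ Set.Ioo a b, ∀ x : ℝ, DifferentiableAt ℝ (fun y => v t y) x)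
    (hcont_n : ContinuousOn (fun p : ℝ × ℝ => n p.1 p.2) (Set.Ioo a b ×ˢ Set.univ))
    (hcont_nt : ContinuousOn (fun p : ℝ × ℝ => deriv (fun s => n s p.2) p.1)
      (Set.Ioo a b ×ˢ Set.univ))
    (hcont_nx : ContinuousOn (fun p : ℝ × ℝ => deriv (fun y => n p.1 y) p.2)
      (Set.Ioo a b ×ˢ Set.univ))
    (hcont_v : ContinuousOn (fun p : ℝ × ℝ => v p.1 p.2) (Set.Ioo a b ×ˢ Set.univ))
    (hcont_vt : ContinuousOn (fun p : ℝ × ℝ => deriv (fun s => v s p.2) p.1)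
      (Set.Ioo a b ×ˢ Set.univ))
    (hcont_vx : ContinuousOn (fun p : ℝ × ℝ => deriv (fun y => v p.1 y) p.2)
      (Set.Ioo a b ×ˢ Set.univ))
    -- the Zakharov system (ZL) holds pointwise on `I × ℝ`
    (hequ : ∀ t ∈ Set.Ioo a b, ∀ x : ℝ,
      deriv (fun s => u s x) t =
        Complex.I * deriv (deriv (fun y => u t y)) x -
          Complex.I * ((n t x : ℝ) : ℂ) * u t x)
    (heqn : ∀ t ∈ Set.Ioo a b, ∀ x : ℝ,
      deriv (fun s => n s x) t = -deriv (fun y => v t y) x)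
    (heqv : ∀ t ∈ Set.Ioo a b, ∀ x : ℝ,
      deriv (fun s => v s x) t =
        -deriv (fun y => n t y) x - deriv (fun y => ‖u t y‖ ^ 2) x)
    -- exponential decay, locally uniformly in `t`
    (hdecay : ∀ J : Set ℝ, IsCompact J → J ⊆ Set.Ioo a b →
      ∃ C : ℝ, 0 < C ∧ ∃ δ : ℝ, 0 < δ ∧ ∀ t ∈ J, ∀ x : ℝ,
        ‖u t x‖ + ‖deriv (fun y => u t y) x‖ + ‖deriv (deriv (fun y => u t y)) x‖ +
            ‖deriv (deriv (deriv (fun y => u t y))) x‖ + |n t x| + |v t x| +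
            |deriv (fun y => n t y) x| + |deriv (fun y => v t y) x| ≤
          C * Real.exp (-δ * |x|))
    -- `χ` is twice continuously differentiable on `I × ℝ` ...
    (hχ_t : ∀ t ∈ Set.Ioo a b, ∀ x : ℝ, DifferentiableAt ℝ (fun s => χ s x) t)
    (hχ_x : ∀ t ∈ Set.Ioo a b, ∀ x : ℝ, DifferentiableAt ℝ (fun y => χ t y) x)
    (hχ_xx : ∀ t ∈ Set.Ioo a b, ∀ x : ℝ,
      DifferentiableAt ℝ (deriv (fun y => χ t y)) x)
    (hcont_χ : ContinuousOn (fun p : ℝ × ℝ => χ p.1 p.2) (Set.Ioo a b ×ˢ Set.univ))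
    (hcont_χt : ContinuousOn (fun p : ℝ × ℝ => deriv (fun s => χ s p.2) p.1)
      (Set.Ioo a b ×ˢ Set.univ))
    (hcont_χx : ContinuousOn (fun p : ℝ × ℝ => deriv (fun y => χ p.1 y) p.2)
      (Set.Ioo a b ×ˢ Set.univ))
    (hcont_χxx : ContinuousOn (fun p : ℝ × ℝ => deriv (deriv (fun y => χ p.1 y)) p.2)
      (Set.Ioo a b ×ˢ Set.univ))
    -- ... with `χ`, `∂_t χ`, `∂_x χ`, `∂_x² χ` bounded on `J × ℝ` for compact `J ⊆ I`
    (hχ_bdd : ∀ J : Set ℝ, IsCompact J → J ⊆ Set.Ioo a b →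
      ∃ C : ℝ, 0 < C ∧ ∀ t ∈ J, ∀ x : ℝ,
        |χ t x| + |deriv (fun s => χ s x) t| + |deriv (fun y => χ t y) x| +
          |deriv (deriv (fun y => χ t y)) x| ≤ C) :
    ∀ t ∈ Set.Ioo a b,
      HasDerivAt (fun s =>
          (∫ x : ℝ, deriv (fun y => u s y) x * (starRingEnd ℂ) (u s x) *
              ((χ s x : ℝ) : ℂ)).im +
            ∫ x : ℝ, n s x * v s x * χ s x)
        (2 * (∫ x : ℝ, ‖deriv (fun y => u t y) x‖ ^ 2 * deriv (fun y => χ t y) x) +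
          (∫ x : ℝ, (starRingEnd ℂ) (u t x) * deriv (fun y => u t y) x *
              ((deriv (deriv (fun y => χ t y)) x : ℝ) : ℂ)).re +
          (∫ x : ℝ, (n t x * ‖u t x‖ ^ 2 + ((v t x) ^ 2 + (n t x) ^ 2) / 2) *
              deriv (fun y => χ t y) x) +
          ∫ x : ℝ, (((starRingEnd ℂ) (u t x) * deriv (fun y => u t y) x).im +
              n t x * v t x) * deriv (fun s => χ s x) t) t := by
  intro t ht
  obtain ⟨ε, hε, hball⟩ := Metric.nhds_basis_closedBall.mem_iff.1 (isOpen_Ioo.mem_nhds ht)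
  have hmem : Metric.closedBall t ε ∈ nhds t := Metric.closedBall_mem_nhds t hε
  have hJc := isCompact_closedBall t ε
  generalize Metric.closedBall t ε = J at hball hmem hJc
  have htJ : t ∈ J := mem_of_mem_nhds hmem
  obtain ⟨C, hC, δ, hδ, hdec⟩ := hdecay J hJc hball
  obtain ⟨D, hD, hχb⟩ := hχ_bdd J hJc hball
  -- decay of components
  have mkR : ∀ f : ℝ → ℝ → ℝ,
      ContinuousOn (fun p : ℝ × ℝ => f p.1 p.2) (Set.Ioo a b ×ˢ Set.univ) →
      (∀ s ∈ J, ∀ x, |f s x| ≤ C * Real.exp (-δ * |x|)) → ZLDec J δ f :=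
    fun f hf hb => ⟨fun s hs => zl_slice hf (hball hs), C, hC.le, hb⟩
  have mk0 : ∀ f : ℝ → ℝ → ℝ,
      ContinuousOn (fun p : ℝ × ℝ => f p.1 p.2) (Set.Ioo a b ×ˢ Set.univ) →
      (∀ s ∈ J, ∀ x, |f s x| ≤ D) → ZLDec J 0 f :=
    fun f hf hb => ⟨fun s hs => zl_slice hf (hball hs), D, hD.le, fun s hs x => by
      simpa using hb s hs x⟩
  have mkre : ∀ f : ℝ → ℝ → ℂ,
      ContinuousOn (fun p : ℝ × ℝ => f p.1 p.2) (Set.Ioo a b ×ˢ Set.univ) →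
      (∀ s ∈ J, ∀ x, ‖f s x‖ ≤ C * Real.exp (-δ * |x|)) →
      ZLDec J δ (fun s x => (f s x).re) :=
    fun f hf hb => mkR _ (Complex.continuous_re.comp_continuousOn hf)
      fun s hs x => (Complex.abs_re_le_norm _).trans (hb s hs x)
  have mkim : ∀ f : ℝ → ℝ → ℂ,
      ContinuousOn (fun p : ℝ × ℝ => f p.1 p.2) (Set.Ioo a b ×ˢ Set.univ) →
      (∀ s ∈ J, ∀ x, ‖f s x‖ ≤ C * Real.exp (-δ * |x|)) →
      ZLDec J δ (fun s x => (f s x).im) :=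
    fun f hf hb => mkR _ (Complex.continuous_im.comp_continuousOn hf)
      fun s hs x => (Complex.abs_im_le_norm _).trans (hb s hs x)
  have hall : ∀ s ∈ J, ∀ x : ℝ, ‖u s x‖ ≤ C * Real.exp (-δ * |x|) ∧
      ‖deriv (fun y => u s y) x‖ ≤ C * Real.exp (-δ * |x|) ∧
      ‖deriv (deriv (fun y => u s y)) x‖ ≤ C * Real.exp (-δ * |x|) ∧
      ‖deriv (deriv (deriv (fun y => u s y))) x‖ ≤ C * Real.exp (-δ * |x|) ∧
      |n s x| ≤ C * Real.exp (-δ * |x|) ∧ |v s x| ≤ C * Real.exp (-δ * |x|) ∧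
      |deriv (fun y => n s y) x| ≤ C * Real.exp (-δ * |x|) ∧
      |deriv (fun y => v s y) x| ≤ C * Real.exp (-δ * |x|) := by
    intro s hs x
    have h := hdec s hs x
    have h0 := norm_nonneg (u s x)
    have h1 := norm_nonneg (deriv (fun y => u s y) x)
    have h2 := norm_nonneg (deriv (deriv (fun y => u s y)) x)
    have h3 := norm_nonneg (deriv (deriv (deriv (fun y => u s y))) x)
    have h4 := abs_nonneg (n s x)
    have h5 := abs_nonneg (v s x)
    have h6 := abs_nonneg (deriv (fun y => n s y) x)
    have h7 := abs_nonneg (deriv (fun y => v s y) x)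
    refine ⟨?_, ?_, ?_, ?_, ?_, ?_, ?_, ?_⟩ <;> linarith
  have hallχ : ∀ s ∈ J, ∀ x : ℝ, |χ s x| ≤ D ∧ |deriv (fun r => χ r x) s| ≤ D ∧
      |deriv (fun y => χ s y) x| ≤ D ∧ |deriv (deriv (fun y => χ s y)) x| ≤ D := by
    intro s hs x
    have h := hχb s hs x
    have h4 := abs_nonneg (χ s x)
    have h5 := abs_nonneg (deriv (fun r => χ r x) s)
    have h6 := abs_nonneg (deriv (fun y => χ s y) x)
    have h7 := abs_nonneg (deriv (deriv (fun y => χ s y)) x)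
    refine ⟨?_, ?_, ?_, ?_⟩ <;> linarith
  have dp0 := mkre (fun s x => u s x) hcont_u fun s hs x => (hall s hs x).1
  have dq0 := mkim (fun s x => u s x) hcont_u fun s hs x => (hall s hs x).1
  have dp1 := mkre (fun s x => deriv (fun y => u s y) x) hcont_ux
    fun s hs x => (hall s hs x).2.1
  have dq1 := mkim (fun s x => deriv (fun y => u s y) x) hcont_ux
    fun s hs x => (hall s hs x).2.1
  have dp2 := mkre (fun s x => deriv (deriv (fun y => u s y)) x) hcont_uxx
    fun s hs x => (hall s hs x).2.2.1
  have dq2 := mkim (fun s x => deriv (deriv (fun y => u s y)) x) hcont_uxx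
    fun s hs x => (hall s hs x).2.2.1
  have dp3 := mkre (fun s x => deriv (deriv (deriv (fun y => u s y))) x) hcont_uxxx
    fun s hs x => (hall s hs x).2.2.2.1
  have dq3 := mkim (fun s x => deriv (deriv (deriv (fun y => u s y))) x) hcont_uxxx
    fun s hs x => (hall s hs x).2.2.2.1
  have dn := mkR (fun s x => n s x) hcont_n fun s hs x => (hall s hs x).2.2.2.2.1
  have dv := mkR (fun s x => v s x) hcont_v fun s hs x => (hall s hs x).2.2.2.2.2.1
  have dnx := mkR (fun s x => deriv (fun y => n s y) x) hcont_nx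
    fun s hs x => (hall s hs x).2.2.2.2.2.2.1
  have dvx := mkR (fun s x => deriv (fun y => v s y) x) hcont_vx
    fun s hs x => (hall s hs x).2.2.2.2.2.2.2
  have dc := mk0 (fun s x => χ s x) hcont_χ fun s hs x => (hallχ s hs x).1
  have dct := mk0 (fun s x => deriv (fun r => χ r x) s) hcont_χt
    fun s hs x => (hallχ s hs x).2.1
  have dcx := mk0 (fun s x => deriv (fun y => χ s y) x) hcont_χx
    fun s hs x => (hallχ s hs x).2.2.1
  have dcxx := mk0 (fun s x => deriv (deriv (fun y => χ s y)) x) hcont_χxx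
    fun s hs x => (hallχ s hs x).2.2.2
  -- time derivatives
  have tu : ∀ s ∈ J, ∀ x, HasDerivAt (fun r => u r x)
      (Complex.I * deriv (deriv (fun y => u s y)) x -
          Complex.I * ((n s x : ℝ) : ℂ) * u s x) s := fun s hs x => by
    rw [← hequ s (hball hs) x]
    exact (hu_t s (hball hs) x).hasDerivAt
  have tux : ∀ s ∈ J, ∀ x, HasDerivAt (fun r => deriv (fun y => u r y) x)
      (Complex.I * deriv (deriv (deriv (fun y => u s y))) x -
          (Complex.I * ((deriv (fun y => n s y) x : ℝ) : ℂ) * u s x +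
            Complex.I * ((n s x : ℝ) : ℂ) * deriv (fun y => u s y) x)) s := fun s hs x => by
    have h1 := zl_mixed a b u (fun s x => deriv (fun r => u r x) s)
      (fun s x => deriv (fun y => u s y) x)
      (fun s x => deriv (fun r => deriv (fun y => u r y) x) s)
      (fun s hs x => (hu_t s hs x).hasDerivAt) (fun s hs x => (hu_x s hs x).hasDerivAt)
      (fun s hs x => (hu_tx s hs x).hasDerivAt) hcont_ux hcont_utx (hball hs) x
    have h2 := ((hu_xxx s (hball hs) x).hasDerivAt.const_mul Complex.I).sub
      (((hn_x s (hball hs) x).hasDerivAt.ofReal_comp.const_mul Complex.I).mul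
        (hu_x s (hball hs) x).hasDerivAt)
    have h3 := h2.congr_of_eventuallyEq
      (Filter.Eventually.of_forall fun y => hequ s (hball hs) y)
    have h4 := (hu_tx s (hball hs) x).hasDerivAt
    rw [h1.unique h3] at h4
    exact h4
  have xsq : ∀ s ∈ J, ∀ x, deriv (fun y => ‖u s y‖ ^ 2) x =
      2 * ((u s x).re * (deriv (fun y => u s y) x).re +
        (u s x).im * (deriv (fun y => u s y) x).im) := fun s hs x => by
    have h := (hu_x s (hball hs) x).hasDerivAt
    have h2 := ((zl_re h).mul (zl_re h)).add ((zl_im h).mul (zl_im h))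
    have h3 : (fun y => ‖u s y‖ ^ 2) =
        fun y => (u s y).re * (u s y).re + (u s y).im * (u s y).im := by
      funext y
      rw [Complex.sq_norm, Complex.normSq_apply]
    rw [h3]
    refine (h2.congr_deriv ?_).deriv
    ring
  have key := zl_core t δ J hmem hδ _ _ _ _ _ _ _ _ _ _ _ _ _ _ _ _
    dp0 dp1 dp2 dp3 dq0 dq1 dq2 dq3 dn dv dnx dvx dc dct dcx dcxx
    (fun x => zl_re (hu_x t ht x).hasDerivAt)
    (fun x => zl_re (hu_xx t ht x).hasDerivAt)
    (fun x => zl_re (hu_xxx t ht x).hasDerivAt)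
    (fun x => zl_im (hu_x t ht x).hasDerivAt)
    (fun x => zl_im (hu_xx t ht x).hasDerivAt)
    (fun x => zl_im (hu_xxx t ht x).hasDerivAt)
    (fun x => (hn_x t ht x).hasDerivAt) (fun x => (hv_x t ht x).hasDerivAt)
    (fun x => (hχ_x t ht x).hasDerivAt) (fun x => (hχ_xx t ht x).hasDerivAt)
    (fun s hs x => (zl_re (tu s hs x)).congr_deriv (by simp))
    (fun s hs x => (zl_im (tu s hs x)).congr_deriv (by simp))
    (fun s hs x => (zl_re (tux s hs x)).congr_deriv (by simp; try ring))
    (fun s hs x => (zl_im (tux s hs x)).congr_deriv (by simp))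
    (fun s hs x => by
      have := (hn_t s (hball hs) x).hasDerivAt
      rwa [heqn s (hball hs) x] at this)
    (fun s hs x => by
      have := (hv_t s (hball hs) x).hasDerivAt
      rwa [heqv s (hball hs) x, xsq s hs x] at this)
    (fun s hs x => (hχ_t s (hball hs) x).hasDerivAt)
  -- integrability of the complex integrands
  have dQ := (((dq1.mul hδ dp0).sub (dp1.mul hδ dq0)).mul0 dc)
  have dQr := (((dp1.mul hδ dp0).add (dq1.mul hδ dq0)).mul0 dc)
  have dR := (((dp0.mul hδ dp1).add (dq0.mul hδ dq1)).mul0 dcxx)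
  have dRi := (((dq1.mul hδ dp0).sub (dp1.mul hδ dq0)).mul0 dcxx)
  have im_eq : ∀ s ∈ J, (∫ x : ℝ, deriv (fun y => u s y) x * (starRingEnd ℂ) (u s x) *
      ((χ s x : ℝ) : ℂ)).im = ∫ x : ℝ, ((deriv (fun y => u s y) x).im * (u s x).re -
        (deriv (fun y => u s y) x).re * (u s x).im) * χ s x := by
    intro s hs
    have hi : Integrable (fun x : ℝ => deriv (fun y => u s y) x * (starRingEnd ℂ) (u s x) *
        ((χ s x : ℝ) : ℂ)) := by
      have h1 := (dQr.integrable hδ hs).ofReal (𝕜 := ℂ)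
      have h2 := ((dQ.integrable hδ hs).ofReal (𝕜 := ℂ)).mul_const Complex.I
      refine (h1.add h2).congr (Filter.Eventually.of_forall fun x => ?_)
      apply Complex.ext <;> simp [-mul_eq_mul_right_iff] <;> ring
    have h := integral_im hi
    simp only [RCLike.im_eq_complex_im] at h
    rw [← h]
    refine integral_congr_ae (Filter.Eventually.of_forall fun x => ?_)
    simp [-mul_eq_mul_right_iff]
    ring
  have re_eq : (∫ x : ℝ, (starRingEnd ℂ) (u t x) * deriv (fun y => u t y) x *
      ((deriv (deriv (fun y => χ t y)) x : ℝ) : ℂ)).re =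
      ∫ x : ℝ, ((u t x).re * (deriv (fun y => u t y) x).re +
        (u t x).im * (deriv (fun y => u t y) x).im) * deriv (deriv (fun y => χ t y)) x := by
    have hi : Integrable (fun x : ℝ => (starRingEnd ℂ) (u t x) * deriv (fun y => u t y) x *
        ((deriv (deriv (fun y => χ t y)) x : ℝ) : ℂ)) := by
      have h1 := (dR.integrable hδ htJ).ofReal (𝕜 := ℂ)
      have h2 := ((dRi.integrable hδ htJ).ofReal (𝕜 := ℂ)).mul_const Complex.I
      refine (h1.add h2).congr (Filter.Eventually.of_forall fun x => ?_)
      apply Complex.ext <;> simp [-mul_eq_mul_right_iff] <;> ring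
    have h := integral_re hi
    simp only [RCLike.re_eq_complex_re] at h
    rw [← h]
    refine integral_congr_ae (Filter.Eventually.of_forall fun x => ?_)
    simp [-mul_eq_mul_right_iff]
  have key2 := key.congr_of_eventuallyEq (f₁ := fun s =>
          (∫ x : ℝ, deriv (fun y => u s y) x * (starRingEnd ℂ) (u s x) *
              ((χ s x : ℝ) : ℂ)).im +
            ∫ x : ℝ, n s x * v s x * χ s x)
    (Filter.eventually_of_mem hmem fun s hs => by
      show _ + _ = _ + _
      rw [im_eq s hs])
  refine key2.congr_deriv ?_
  rw [re_eq]
  congr 1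
  · congr 1
    · congr 2
      refine integral_congr_ae (Filter.Eventually.of_forall fun x => ?_)
      simp only [Complex.sq_norm, Complex.normSq_apply]
    · refine integral_congr_ae (Filter.Eventually.of_forall fun x => ?_)
      simp only [Complex.sq_norm, Complex.normSq_apply]
      ring
  · refine integral_congr_ae (Filter.Eventually.of_forall fun x => ?_)
    simp [-mul_eq_mul_right_iff]
    ring
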